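/- arXiv:1406.6830 — 4 statements merged into one kernel-verified Lean document; each statement's English description precedes it below -/
import Mathlib

section
/- Let β₁, …, β_d ∈ 𝔹 be pairwise distinct quaternions in the open unit ball such that no three of them lie on a common sphere [·]. Then the sequences k_{β_j} = (β̄_jⁿ)_{n∈ℕ}, j = 1, …, d, are right ℍ-linearly independent in ℓ²(ℕ, ℍ): if Σ_{j=1}^d k_{β_j} c_j = 0 with c_j ∈ ℍ, then c₁ = ⋯ = c_d = 0. -/
open Quaternion

/-- The 2-sphere `[a]` of quaternions with the same real part and imaginary modulus as `a`. -/
def sphereClass (a : Quaternion ℝ) : Set (Quaternion ℝ) :=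
  {q | q.re = a.re ∧ ‖q - (q.re : Quaternion ℝ)‖ = ‖a - (a.re : Quaternion ℝ)‖}

open Polynomial in
/-- The real quadratic polynomial `X² - 2 Re(b) X + |b|²` whose quaternionic zero set is `[b]`. -/
noncomputable def sphereQuadratic (b : Quaternion ℝ) : ℝ[X] :=
  X ^ 2 - C (2 * b.re) * X + C (b.re ^ 2 + b.imI ^ 2 + b.imJ ^ 2 + b.imK ^ 2)

theorem mem_sphereClass_iff (a q : Quaternion ℝ) :
    q ∈ sphereClass a ↔ q.re = a.re ∧
      q.imI ^ 2 + q.imJ ^ 2 + q.imK ^ 2 = a.imI ^ 2 + a.imJ ^ 2 + a.imK ^ 2 := by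
  have h (x : Quaternion ℝ) :
      ‖x - (x.re : Quaternion ℝ)‖ ^ 2 = x.imI ^ 2 + x.imJ ^ 2 + x.imK ^ 2 := by
    rw [sq, ← Quaternion.normSq_eq_norm_mul_self, Quaternion.normSq_def']
    simp
  rw [← h, ← h, sq_eq_sq₀ (norm_nonneg _) (norm_nonneg _)]
  rfl

theorem aeval_star_sphereQuadratic_eq_zero_iff (a b : Quaternion ℝ) :
    Polynomial.aeval (star a) (sphereQuadratic b) = 0 ↔ a ∈ sphereClass b := by
  have key : Polynomial.aeval (star a) (sphereQuadratic b) =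
      star a * star a - ((2 * b.re : ℝ) : Quaternion ℝ) * star a +
        ((b.re ^ 2 + b.imI ^ 2 + b.imJ ^ 2 + b.imK ^ 2 : ℝ) : Quaternion ℝ) := by
    rw [sphereQuadratic, map_add, map_sub, map_mul, map_pow, Polynomial.aeval_X,
      Polynomial.aeval_C, Polynomial.aeval_C, sq (star a)]
    rfl
  rw [key, mem_sphereClass_iff, Quaternion.ext_iff]
  simp only [Quaternion.re_add, Quaternion.re_sub, Quaternion.re_mul, Quaternion.re_star,
    Quaternion.imI_add, Quaternion.imI_sub, Quaternion.imI_mul, Quaternion.imI_star,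
    Quaternion.imJ_add, Quaternion.imJ_sub, Quaternion.imJ_mul, Quaternion.imJ_star,
    Quaternion.imK_add, Quaternion.imK_sub, Quaternion.imK_mul, Quaternion.imK_star,
    Quaternion.re_coe, Quaternion.imI_coe, Quaternion.imJ_coe, Quaternion.imK_coe,
    Quaternion.re_zero, Quaternion.imI_zero, Quaternion.imJ_zero, Quaternion.imK_zero]
  constructor
  · rintro ⟨h0, h1, h2, h3⟩
    have hre : a.re = b.re := by
      by_contra hne
      have hs : a.re - b.re ≠ 0 := sub_ne_zero.mpr hne
      have e1 : a.imI = 0 :=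
        (mul_eq_zero.mp (by linarith : (a.re - b.re) * a.imI = 0)).resolve_left hs
      have e2 : a.imJ = 0 :=
        (mul_eq_zero.mp (by linarith : (a.re - b.re) * a.imJ = 0)).resolve_left hs
      have e3 : a.imK = 0 :=
        (mul_eq_zero.mp (by linarith : (a.re - b.re) * a.imK = 0)).resolve_left hs
      rw [e1, e2, e3] at h0
      nlinarith [sq_pos_of_ne_zero hs, sq_nonneg b.imI, sq_nonneg b.imJ, sq_nonneg b.imK]
    refine ⟨hre, ?_⟩
    rw [hre] at h0
    linarith
  · rintro ⟨hre, him⟩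
    rw [hre]
    refine ⟨?_, ?_, ?_, ?_⟩ <;> linarith

/-- Quaternionic moments that vanish against all powers vanish against all real polynomials. -/
theorem sum_aeval_mul_eq_zero {ι : Type*} [Fintype ι] (q c : ι → Quaternion ℝ)
    (hc : ∀ n : ℕ, ∑ j, q j ^ n * c j = 0) (p : Polynomial ℝ) :
    ∑ j, Polynomial.aeval (q j) p * c j = 0 := by
  simp_rw [Polynomial.aeval_eq_sum_range, Finset.sum_mul]
  rw [Finset.sum_comm]
  refine Finset.sum_eq_zero fun n _ => ?_
  simp_rw [smul_mul_assoc]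
  rw [← Finset.smul_sum, hc, smul_zero]

/-- Let `β₁, …, β_d ∈ 𝔹` be pairwise distinct, no three of them on a common sphere.  Then the
kernel sequences `k_{β_j} = (β̄_jⁿ)ₙ` are right ℍ-linearly independent in `ℓ²(ℕ, ℍ)`:
if `Σ_j k_{β_j} c_j = 0` then all `c_j = 0`. -/
theorem kernel_sequences_linearIndependent (d : ℕ) (β : Fin d → Quaternion ℝ)
    (hβ : ∀ j, ‖β j‖ < 1) (hinj : Function.Injective β)
    (h3 : ∀ i j k : Fin d, i ≠ j → i ≠ k → j ≠ k →
      ¬(β j ∈ sphereClass (β i) ∧ β k ∈ sphereClass (β i)))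
    (c : Fin d → Quaternion ℝ)
    (hc : ∀ n : ℕ, ∑ j, (star (β j)) ^ n * c j = 0) :
    ∀ j, c j = 0 := by
  classical
  intro j
  have hsymm {a b : Quaternion ℝ} (h : a ∈ sphereClass b) : b ∈ sphereClass a :=
    ⟨h.1.symm, h.2.symm⟩
  set S := Finset.univ.filter fun k => β k ∉ sphereClass (β j) with hS
  set P : Polynomial ℝ := ∏ k ∈ S, sphereQuadratic (β k) with hP
  have hPj : Polynomial.aeval (star (β j)) P ≠ 0 := by
    refine Finset.prod_induction _ (fun p => Polynomial.aeval (star (β j)) p ≠ 0)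
      (fun p q hp hq => by rw [map_mul]; exact mul_ne_zero hp hq) (by simp) fun k hk h => ?_
    exact (Finset.mem_filter.mp hk).2
      (hsymm ((aeval_star_sphereQuadratic_eq_zero_iff _ _).mp h))
  have hPS (k) (hk : β k ∉ sphereClass (β j)) : Polynomial.aeval (star (β k)) P = 0 := by
    have hkS : k ∈ S := by simpa [hS] using hk
    rw [hP, ← Finset.prod_erase_mul _ _ hkS, map_mul,
      (aeval_star_sphereQuadratic_eq_zero_iff _ _).mpr ⟨rfl, rfl⟩, mul_zero]
  have hsum := sum_aeval_mul_eq_zero (fun j => star (β j)) c hc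
  suffices h : Polynomial.aeval (star (β j)) P * c j = 0 from
    (mul_eq_zero.mp h).resolve_left hPj
  by_cases hex : ∃ k, k ≠ j ∧ β k ∈ sphereClass (β j)
  · obtain ⟨k, hkj, hk⟩ := hex
    have hpair (Q : Polynomial ℝ) : Polynomial.aeval (star (β j)) (Q * P) * c j +
        Polynomial.aeval (star (β k)) (Q * P) * c k = 0 := by
      rw [← hsum (Q * P)]
      symm
      refine Fintype.sum_eq_add j k hkj.symm fun i hi => ?_
      rw [map_mul, hPS i fun h => h3 j k i hkj.symm hi.1.symm hi.2.symm ⟨hk, h⟩]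
      simp
    have h0 := hpair 1
    have h1 := hpair Polynomial.X
    simp only [one_mul] at h0
    simp only [map_mul, Polynomial.aeval_X, mul_assoc] at h1
    rw [eq_neg_of_add_eq_zero_right h0, mul_neg, ← sub_eq_add_neg, ← sub_mul] at h1
    exact (mul_eq_zero.mp h1).resolve_left
      (sub_ne_zero.mpr fun h => hkj (hinj (star_injective h)).symm)
  · push Not at hex
    rw [← hsum P]
    symm
    refine Fintype.sum_eq_single j fun i hi => ?_
    rw [hPS i (hex i hi), zero_mul]
end

section
/- Let x₀ ∈ ℝ with |x₀| < 1. Then the map b(p) = (p + x₀)(1 + px₀)⁻¹ is a well-defined bijection of the open quaternionic unit ball 𝔹 onto itself, with inverse q ↦ (q − x₀)(1 − qx₀)⁻¹; in particular |b(p)| < 1 for every p ∈ 𝔹 and 1 + px₀ ≠ 0 for every p ∈ 𝔹. -/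
open Quaternion

theorem moebius_left_inv {D : Type*} [DivisionRing D] {c p : D} (hc : ∀ a : D, Commute c a)
    (hu : 1 + p * c ≠ 0) (hcc : 1 - c * c ≠ 0) :
    ((p + c) * (1 + p * c)⁻¹ - c) * (1 - (p + c) * (1 + p * c)⁻¹ * c)⁻¹ = p := by
  have hnum : (p + c) * (1 + p * c)⁻¹ - c = p * (1 - c * c) * (1 + p * c)⁻¹ := by
    rw [eq_mul_inv_iff_mul_eq₀ hu, sub_mul, inv_mul_cancel_right₀ hu, mul_add, ← mul_assoc c p c,
      (hc p).eq]
    noncomm_ring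
  have hden : 1 - (p + c) * (1 + p * c)⁻¹ * c = (1 - c * c) * (1 + p * c)⁻¹ := by
    rw [eq_mul_inv_iff_mul_eq₀ hu, sub_mul, mul_assoc _ c, (hc _).eq, ← mul_assoc,
      inv_mul_cancel_right₀ hu]
    noncomm_ring
  rw [hnum, hden, mul_inv_rev, inv_inv, mul_assoc, inv_mul_cancel_left₀ hu,
    mul_inv_cancel_right₀ hcc]

theorem Quaternion.one_add_mul_coe_ne_zero {x₀ : ℝ} (hx : |x₀| < 1) {p : Quaternion ℝ}
    (hp : ‖p‖ < 1) : 1 + p * (x₀ : Quaternion ℝ) ≠ 0 := by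
  intro h
  have hnorm : ‖p‖ * |x₀| = 1 := by
    rw [← Real.norm_eq_abs, ← norm_coe, ← norm_mul, ← neg_eq_of_add_eq_zero_right h]
    simp
  nlinarith [norm_nonneg p, abs_nonneg x₀]

theorem Quaternion.norm_moebius_lt_one {x₀ : ℝ} (hx : |x₀| < 1) {p : Quaternion ℝ}
    (hp : ‖p‖ < 1) :
    ‖(p + (x₀ : Quaternion ℝ)) * (1 + p * (x₀ : Quaternion ℝ))⁻¹‖ < 1 := by
  have hu := one_add_mul_coe_ne_zero hx hp
  rw [norm_mul, norm_inv, ← div_eq_mul_inv, div_lt_one (norm_pos_iff.mpr hu)]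
  refine lt_of_pow_lt_pow_left₀ 2 (norm_nonneg _) ?_
  have hp2 : ‖p‖ * ‖p‖ < 1 := by nlinarith [norm_nonneg p]
  have hx2 : x₀ ^ 2 < 1 := (sq_lt_one_iff_abs_lt_one x₀).mpr hx
  rw [← normSq_eq_norm_mul_self, normSq_def'] at hp2
  rw [pow_two, pow_two, ← normSq_eq_norm_mul_self, ← normSq_eq_norm_mul_self, normSq_def',
    normSq_def']
  simp only [re_add, re_coe, imI_add, imI_coe, add_zero, imJ_add, imJ_coe, imK_add, imK_coe, re_one,
    re_mul, mul_zero, sub_zero, imI_one, imI_mul, zero_add, imJ_one, imJ_mul, sub_self, imK_one, imK_mul]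
  nlinarith [mul_pos (sub_pos.mpr hp2) (sub_pos.mpr hx2)]

/-- For real `x₀` with `|x₀| < 1`, the map `b(p) = (p + x₀)(1 + px₀)⁻¹` is a well-defined
bijection of the open quaternionic unit ball onto itself, with inverse
`q ↦ (q − x₀)(1 − qx₀)⁻¹`; in particular `1 + px₀ ≠ 0` for every `p ∈ 𝔹`. -/
theorem moebius_real_selfmap_ball (x₀ : ℝ) (hx : |x₀| < 1) :
    (∀ p : Quaternion ℝ, ‖p‖ < 1 → 1 + p * (x₀ : Quaternion ℝ) ≠ 0) ∧
    Set.BijOn (fun p : Quaternion ℝ => (p + (x₀ : Quaternion ℝ)) *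
        (1 + p * (x₀ : Quaternion ℝ))⁻¹)
      {p : Quaternion ℝ | ‖p‖ < 1} {p : Quaternion ℝ | ‖p‖ < 1} ∧
    Set.InvOn (fun q : Quaternion ℝ => (q - (x₀ : Quaternion ℝ)) *
        (1 - q * (x₀ : Quaternion ℝ))⁻¹)
      (fun p : Quaternion ℝ => (p + (x₀ : Quaternion ℝ)) *
        (1 + p * (x₀ : Quaternion ℝ))⁻¹)
      {p : Quaternion ℝ | ‖p‖ < 1} {p : Quaternion ℝ | ‖p‖ < 1} := by
  have hx' : |-x₀| < 1 := by rwa [abs_neg]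
  have hcc : 1 - (x₀ : Quaternion ℝ) * (x₀ : Quaternion ℝ) ≠ 0 := by
    have h : 1 - x₀ * x₀ ≠ 0 := by
      have := (sq_lt_one_iff_abs_lt_one x₀).mpr hx
      nlinarith
    exact fun h0 => h (coe_injective (by simpa using h0))
  have hinv : Set.InvOn (fun q : Quaternion ℝ => (q - (x₀ : Quaternion ℝ)) *
        (1 - q * (x₀ : Quaternion ℝ))⁻¹)
      (fun p : Quaternion ℝ => (p + (x₀ : Quaternion ℝ)) *
        (1 + p * (x₀ : Quaternion ℝ))⁻¹)
      {p : Quaternion ℝ | ‖p‖ < 1} {p : Quaternion ℝ | ‖p‖ < 1} := by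
    refine ⟨fun p hp => ?_, fun q hq => ?_⟩
    · exact moebius_left_inv (coe_commutes x₀) (one_add_mul_coe_ne_zero hx hp) hcc
    · have h := moebius_left_inv (coe_commutes (-x₀)) (one_add_mul_coe_ne_zero hx' hq)
        (by simpa using hcc)
      simpa [sub_eq_add_neg] using h
  refine ⟨fun p hp => one_add_mul_coe_ne_zero hx hp, hinv.bijOn ?_ ?_, hinv⟩
  · exact fun p hp => norm_moebius_lt_one hx hp
  · intro q hq
    simpa [sub_eq_add_neg] using norm_moebius_lt_one hx' hq
end

section
/- Let n ≥ 1 and α₁, …, αₙ ∈ ℍ, and let Q = (X − α₁) ⋆ (X − α₂) ⋆ ⋯ ⋆ (X − αₙ) be the product of the linear factors in the ring of quaternionic polynomials (convolution product with X central). Then Q(α₁) = 0, and every root of Q lies on one of the spheres of the factors: if p ∈ ℍ satisfies Q(p) = 0, then p ∈ [α_j] for some j ∈ {1, …, n}. -/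
open Quaternion Polynomial

/-- Right evaluation of a quaternionic polynomial `Q = Σₖ Xᵏ qₖ` at `p`: `Q(p) = Σₖ pᵏ qₖ`. -/
noncomputable def evalR (p : Quaternion ℝ) (Q : Polynomial (Quaternion ℝ)) : Quaternion ℝ :=
  ∑ k ∈ Finset.range (Q.natDegree + 1), p ^ k * Q.coeff k

theorem evalR_eq_sum (p : Quaternion ℝ) (Q : Polynomial (Quaternion ℝ)) :
    evalR p Q = Q.sum fun k q => p ^ k * q :=
  (Polynomial.sum_over_range Q fun _ => mul_zero _).symm

theorem evalR_add (p : Quaternion ℝ) (P Q : Polynomial (Quaternion ℝ)) :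
    evalR p (P + Q) = evalR p P + evalR p Q := by
  simp only [evalR_eq_sum]
  exact Polynomial.sum_add_index P Q _ (fun _ => mul_zero _) fun _ _ _ => mul_add _ _ _

theorem evalR_monomial (p : Quaternion ℝ) (k : ℕ) (r : Quaternion ℝ) :
    evalR p (monomial k r) = p ^ k * r := by
  rw [evalR_eq_sum]
  exact Polynomial.sum_monomial_index r (fun k q => p ^ k * q) (mul_zero _)

theorem evalR_one (p : Quaternion ℝ) : evalR p 1 = 1 := by
  simp [evalR]

theorem evalR_X_sub_C_mul {p a d : Quaternion ℝ} (h : SemiconjBy (p - a) d p)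
    (R : Polynomial (Quaternion ℝ)) :
    evalR p ((X - C a) * R) = (p - a) * evalR d R := by
  induction R using Polynomial.induction_on' with
  | add P Q hP hQ => rw [mul_add, evalR_add, evalR_add, hP, hQ, mul_add]
  | monomial k r =>
    have hmul : (X - C a) * monomial k r = monomial (k + 1) r + monomial k (-(a * r)) := by
      rw [sub_mul, X_mul_monomial, C_mul_monomial, map_neg, sub_eq_add_neg]
    rw [hmul, evalR_add, evalR_monomial, evalR_monomial, evalR_monomial, ← mul_assoc,
      (h.pow_right k).eq]
    noncomm_ring

theorem mem_sphereClass_of_semiconjBy {c d p a : Quaternion ℝ} (hc : c ≠ 0)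
    (h : SemiconjBy c d p) (hd : d ∈ sphereClass a) : p ∈ sphereClass a := by
  have hre : p.re = d.re := by
    have hp : p = c * d * c⁻¹ := by rw [h.eq, mul_assoc, mul_inv_cancel₀ hc, mul_one]
    have hd : d = c⁻¹ * (c * d) := by rw [← mul_assoc, inv_mul_cancel₀ hc, one_mul]
    rw [hp]
    conv_rhs => rw [hd]
    simp only [Quaternion.re_mul]
    ring
  have hnorm : ‖p - (p.re : Quaternion ℝ)‖ = ‖d - (d.re : Quaternion ℝ)‖ := by
    have hcomm : c * (d - (d.re : Quaternion ℝ)) = (p - (d.re : Quaternion ℝ)) * c := by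
      rw [mul_sub, sub_mul, h.eq, Quaternion.coe_commutes]
    have := congrArg norm hcomm
    rw [norm_mul, norm_mul, mul_comm] at this
    rw [hre]
    exact (mul_right_cancel₀ (norm_ne_zero_iff.mpr hc) this).symm
  exact ⟨hre.trans hd.1, hnorm.trans hd.2⟩

theorem exists_mem_sphereClass_of_evalR_prod_eq_zero (l : List (Quaternion ℝ))
    (p : Quaternion ℝ) (h : evalR p (l.map fun a => X - C a).prod = 0) :
    ∃ a ∈ l, p ∈ sphereClass a := by
  induction l generalizing p with
  | nil => simp [evalR_one] at h
  | cons a l ih =>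
    by_cases hc : p - a = 0
    · exact ⟨a, List.mem_cons_self, by rw [sub_eq_zero.mp hc]; exact ⟨rfl, rfl⟩⟩
    · have hs : SemiconjBy (p - a) ((p - a)⁻¹ * p * (p - a)) p := by
        rw [SemiconjBy, mul_assoc, mul_inv_cancel_left₀ hc]
      rw [List.map_cons, List.prod_cons, evalR_X_sub_C_mul hs] at h
      obtain ⟨b, hb, hmem⟩ := ih _ ((mul_eq_zero.mp h).resolve_left hc)
      exact ⟨b, List.mem_cons_of_mem _ hb, mem_sphereClass_of_semiconjBy hc hs hmem⟩

/-- Let `Q = (X − α₁) ⋆ ⋯ ⋆ (X − αₙ)` be a ⋆-product of linear factors in the ring of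
quaternionic polynomials.  Then `Q(α₁) = 0` and every root of `Q` lies on one of the spheres
`[α_j]`. -/
theorem starProduct_linear_factors_roots (n : ℕ) (hn : 1 ≤ n)
    (α : Fin n → Quaternion ℝ) :
    evalR (α ⟨0, hn⟩) ((List.ofFn fun j => (X - C (α j))).prod) = 0 ∧
    ∀ p : Quaternion ℝ, evalR p ((List.ofFn fun j => (X - C (α j))).prod) = 0 →
      ∃ j, p ∈ sphereClass (α j) := by
  constructor
  · obtain ⟨m, rfl⟩ := Nat.exists_eq_add_of_le' hn
    have hs : SemiconjBy (α 0 - α 0) 0 (α 0) := by simp [SemiconjBy]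
    rw [List.ofFn_succ, List.prod_cons]
    exact (evalR_X_sub_C_mul hs _).trans (by rw [sub_self, zero_mul])
  · intro p hp
    have hmap : (List.ofFn fun j => X - C (α j)) = (List.ofFn α).map fun a => X - C a := by
      rw [List.map_ofFn]
      rfl
    rw [hmap] at hp
    obtain ⟨a, ha, hpa⟩ := exists_mem_sphereClass_of_evalR_prod_eq_zero _ p hp
    obtain ⟨j, rfl⟩ := List.mem_ofFn.mp ha
    exact ⟨j, hpa⟩
end

section
/- Define δ₀ : 𝔻 → ℂ on the open unit disc 𝔻 = {z ∈ ℂ : |z| < 1} by δ₀(0) = 1 and δ₀(z) = 0 for z ≠ 0, and define the kernel K(z, w) = (1 − z w̄)⁻¹ − δ₀(z)δ₀(w) for z, w ∈ 𝔻. Then K has exactly one negative square on 𝔻: for every N ∈ ℕ and every choice of points w₁, …, w_N ∈ 𝔻, the N × N Hermitian matrix with (i, j) entry K(w_i, w_j) has at most one strictly negative eigenvalue (counted with multiplicity), and there exist N and points w₁, …, w_N ∈ 𝔻 for which this matrix has exactly one strictly negative eigenvalue. -/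
/-- `δ₀(0) = 1` and `δ₀(z) = 0` for `z ≠ 0`, on the unit disc. -/
noncomputable def delta0 (z : ℂ) : ℂ := if z = 0 then 1 else 0

/-- The kernel `K(z, w) = (1 − z w̄)⁻¹ − δ₀(z)δ₀(w)`. -/
noncomputable def Kdelta (z w : ℂ) : ℂ :=
  (1 - z * (starRingEnd ℂ) w)⁻¹ - delta0 z * delta0 w

open scoped ComplexOrder Matrix

/-- A Hermitian matrix whose quadratic form is nonnegative on the hyperplane `{x | d ⬝ᵥ x = 0}`
has at most one negative eigenvalue. -/
theorem Matrix.IsHermitian.card_neg_eigenvalues_le_one {n : Type*} [Fintype n] [DecidableEq n]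
    {A : Matrix n n ℂ} (hA : A.IsHermitian) (d : n → ℂ)
    (h : ∀ x : n → ℂ, d ⬝ᵥ x = 0 → 0 ≤ star x ⬝ᵥ A *ᵥ x) :
    Nat.card {i : n // hA.eigenvalues i < 0} ≤ 1 := by
  rw [Finite.card_le_one_iff_subsingleton]
  refine ⟨fun ⟨i, hi⟩ ⟨j, hj⟩ => ?_⟩
  by_contra hne
  have hij : i ≠ j := fun e => hne (Subtype.ext e)
  have inner_eq (k l : n) : star (hA.eigenvectorBasis k : n → ℂ) ⬝ᵥ (hA.eigenvectorBasis l : n → ℂ)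
      = if k = l then 1 else 0 := by
    rw [dotProduct_comm, ← EuclideanSpace.inner_eq_star_dotProduct]
    exact orthonormal_iff_ite.mp hA.eigenvectorBasis.orthonormal k l
  have form_eq (a b : ℂ) (hab : d ⬝ᵥ (a • (hA.eigenvectorBasis i : n → ℂ)
      + b • (hA.eigenvectorBasis j : n → ℂ)) = 0) :
      0 ≤ hA.eigenvalues i * Complex.normSq a + hA.eigenvalues j * Complex.normSq b := by
    have key := h _ hab
    rw [Matrix.mulVec_add, Matrix.mulVec_smul, Matrix.mulVec_smul, hA.mulVec_eigenvectorBasis,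
      hA.mulVec_eigenvectorBasis] at key
    simp only [star_add, star_smul, add_dotProduct, dotProduct_add, smul_dotProduct,
      dotProduct_smul, inner_eq, if_neg hij, if_neg hij.symm, if_true, smul_eq_mul,
      Complex.real_smul, mul_zero, add_zero, zero_add, mul_one] at key
    rw [← Complex.zero_le_real]
    convert key using 1
    push_cast [Complex.normSq_eq_conj_mul_self]
    simp only [RCLike.star_def]
    ring
  by_cases hd : d ⬝ᵥ (hA.eigenvectorBasis i : n → ℂ) = 0
  · have := form_eq 1 0 (by simp [hd])
    simp at this
    linarith
  · have := form_eq (d ⬝ᵥ (hA.eigenvectorBasis j : n → ℂ))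
      (-(d ⬝ᵥ (hA.eigenvectorBasis i : n → ℂ)))
      (by simp only [dotProduct_add, dotProduct_smul, smul_eq_mul]; ring)
    rw [Complex.normSq_neg] at this
    nlinarith [Complex.normSq_pos.mpr hd,
      Complex.normSq_nonneg (d ⬝ᵥ (hA.eigenvectorBasis j : n → ℂ))]

/-- The Szegő kernel `(1 - z w̄)⁻¹` is positive semidefinite on the unit disc. -/
theorem szego_form_nonneg {n : Type*} [Fintype n] (w : n → ℂ) (hw : ∀ i, ‖w i‖ < 1) (x : n → ℂ) :
    0 ≤ star x ⬝ᵥ (Matrix.of fun i j => (1 - w i * (starRingEnd ℂ) (w j))⁻¹) *ᵥ x := by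
  have hs : HasSum (fun m : ℕ => ∑ i, ∑ j,
      star (x i) * (w i * (starRingEnd ℂ) (w j)) ^ m * x j)
      (∑ i, ∑ j, star (x i) * (1 - w i * (starRingEnd ℂ) (w j))⁻¹ * x j) := by
    have hterm (i j : n) : HasSum (fun m : ℕ => star (x i) * (w i * (starRingEnd ℂ) (w j)) ^ m * x j)
        (star (x i) * (1 - w i * (starRingEnd ℂ) (w j))⁻¹ * x j) := by
      have hlt : ‖w i * (starRingEnd ℂ) (w j)‖ < 1 := by
        rw [norm_mul, RCLike.norm_conj]
        exact mul_lt_one_of_nonneg_of_lt_one_left (norm_nonneg _) (hw i) (hw j).le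
      exact ((hasSum_geometric_of_norm_lt_one hlt).mul_left _).mul_right _
    exact hasSum_sum fun i _ => hasSum_sum fun j _ => hterm i j
  have heq : star x ⬝ᵥ (Matrix.of fun i j => (1 - w i * (starRingEnd ℂ) (w j))⁻¹) *ᵥ x
      = ∑ i, ∑ j, star (x i) * (1 - w i * (starRingEnd ℂ) (w j))⁻¹ * x j := by
    simp [dotProduct, Matrix.mulVec, Finset.mul_sum, mul_assoc]
  rw [heq]
  refine hs.nonneg fun m => ?_
  have hsq : ∑ i, ∑ j, star (x i) * (w i * (starRingEnd ℂ) (w j)) ^ m * x j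
      = star (∑ j, star (w j) ^ m * x j) * ∑ j, star (w j) ^ m * x j := by
    rw [star_sum, Finset.sum_mul_sum]
    refine Finset.sum_congr rfl fun i _ => Finset.sum_congr rfl fun j _ => ?_
    simp only [star_mul', star_pow, mul_pow, RCLike.star_def, Complex.conj_conj]
    ring
  rw [hsq]
  exact star_mul_self_nonneg _

theorem Kdelta_form_eq {n : Type*} [Fintype n] (w : n → ℂ) (x : n → ℂ)
    (hx : (fun i => delta0 (w i)) ⬝ᵥ x = 0) :
    star x ⬝ᵥ (Matrix.of fun i j => Kdelta (w i) (w j)) *ᵥ x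
      = star x ⬝ᵥ (Matrix.of fun i j => (1 - w i * (starRingEnd ℂ) (w j))⁻¹) *ᵥ x := by
  have hK : (Matrix.of fun i j => Kdelta (w i) (w j))
      = (Matrix.of fun i j => (1 - w i * (starRingEnd ℂ) (w j))⁻¹)
        - Matrix.vecMulVec (fun i => delta0 (w i)) (fun i => delta0 (w i)) := by
    ext i j
    simp [Kdelta, Matrix.vecMulVec_apply]
  rw [hK, Matrix.sub_mulVec, Matrix.vecMulVec_mulVec, hx]
  simp

theorem Kdelta_card_neg_eigenvalues_le_one (N : ℕ) (w : Fin N → ℂ) (hw : ∀ i, ‖w i‖ < 1)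
    (hH : (Matrix.of fun i j => Kdelta (w i) (w j)).IsHermitian) :
    Nat.card {i : Fin N // hH.eigenvalues i < 0} ≤ 1 :=
  hH.card_neg_eigenvalues_le_one (fun i => delta0 (w i)) fun x hx => by
    rw [Kdelta_form_eq w x hx]
    exact szego_form_nonneg w hw x

theorem Kdelta_conj (z w : ℂ) : star (Kdelta z w) = Kdelta w z := by
  have hd (u : ℂ) : (starRingEnd ℂ) (delta0 u) = delta0 u := by
    unfold delta0; split_ifs <;> simp
  simp [Kdelta, hd, mul_comm]

/-- The kernel `K(z, w) = (1 − z w̄)⁻¹ − δ₀(z)δ₀(w)` has exactly one negative square on the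
open unit disc `𝔻`: every Hermitian matrix `(K(w_i, w_j))_{i,j}` built from points of `𝔻` has
at most one strictly negative eigenvalue (with multiplicity), and some choice of points
yields exactly one strictly negative eigenvalue. -/
theorem Kdelta_one_negative_square :
    (∀ (N : ℕ) (w : Fin N → ℂ), (∀ i, ‖w i‖ < 1) →
      ∀ hH : (Matrix.of fun i j => Kdelta (w i) (w j)).IsHermitian,
        Nat.card {i : Fin N // hH.eigenvalues i < 0} ≤ 1) ∧
    (∃ (N : ℕ) (w : Fin N → ℂ), (∀ i, ‖w i‖ < 1) ∧
      ∃ hH : (Matrix.of fun i j => Kdelta (w i) (w j)).IsHermitian,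
        Nat.card {i : Fin N // hH.eigenvalues i < 0} = 1) := by
  refine ⟨Kdelta_card_neg_eigenvalues_le_one, 2, ![0, 1 / 2], ?_⟩
  have hw : ∀ i, ‖(![0, 1 / 2] : Fin 2 → ℂ) i‖ < 1 := by
    intro i
    fin_cases i <;> norm_num
  have hH : (Matrix.of fun i j => Kdelta ((![0, 1 / 2] : Fin 2 → ℂ) i)
      ((![0, 1 / 2] : Fin 2 → ℂ) j)).IsHermitian :=
    Matrix.IsHermitian.ext fun i j => Kdelta_conj _ _
  refine ⟨hw, hH, le_antisymm (Kdelta_card_neg_eigenvalues_le_one 2 _ hw hH) ?_⟩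
  have hdet := hH.det_eq_prod_eigenvalues
  have hprod : ∏ i, hH.eigenvalues i = -1 := by
    rw [← Complex.ofReal_inj, Complex.ofReal_prod]
    refine hdet.symm.trans ?_
    simp [Matrix.det_fin_two, Kdelta, delta0]
  obtain ⟨i, hi⟩ : ∃ i, hH.eigenvalues i < 0 := by
    by_contra! hpos
    linarith [Finset.prod_nonneg fun i (_ : i ∈ Finset.univ) => hpos i]
  have : Nonempty {i : Fin 2 // hH.eigenvalues i < 0} := ⟨⟨i, hi⟩⟩
  exact Nat.card_pos
end
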